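/- arXiv:1901.04348 — 3 statements merged into one kernel-verified Lean document; each statement's English description precedes it below -/
import Mathlib

section
/- Let ∂ : C → Γ be a crossed module over a group Γ, and suppose Γ is a free group. Then C is isomorphic as a group to the direct product (ker ∂) × (range ∂). -/
/-- A crossed module over `Γ` : a homomorphism `∂ : C →* Γ` together with a right action of
`Γ` on `C` by group automorphisms, satisfying equivariance and the Peiffer identity. -/
structure IsCrossedModule {C Γ : Type*} [Group C] [Group Γ]
    (bd : C →* Γ) (act : C → Γ → C) : Prop where
  act_one : ∀ t, act t 1 = t
  act_act : ∀ t g h, act t (g * h) = act (act t g) h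
  act_mul : ∀ t u g, act (t * u) g = act t g * act u g
  equivariant : ∀ t g, bd (act t g) = g⁻¹ * bd t * g
  peiffer : ∀ t u, act t (bd u) = u⁻¹ * t * u

/-- If `∂ : C → Γ` is a crossed module over a free group `Γ`, then `C` is isomorphic as a
group to the direct product `(ker ∂) × (range ∂)`. -/
theorem stmt_8 {C Γ : Type*} [Group C] [Group Γ] [IsFreeGroup Γ]
    (bd : C →* Γ) (act : C → Γ → C) (h : IsCrossedModule bd act) :
    Nonempty (C ≃* (bd.ker × bd.range)) := by
  obtain ⟨ι, ⟨b⟩⟩ := IsFreeGroup.nonempty_basis (G := bd.range)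
  choose f hf using fun i : ι => bd.rangeRestrict_surjective (b i)
  let s : bd.range →* C := (FreeGroup.lift f).comp b.repr.toMonoidHom
  have hs0 : bd.rangeRestrict.comp (FreeGroup.lift f) = b.repr.symm.toMonoidHom := by
    ext i
    have := congrArg Subtype.val (hf i)
    simp only [MonoidHom.comp_apply, FreeGroup.lift_apply_of]
    exact this
  have hs : ∀ r, bd.rangeRestrict (s r) = r := by
    intro r
    have := DFunLike.congr_fun hs0 (b.repr r)
    simpa [s] using this
  have hs' : ∀ r, bd (s r) = r := fun r => congrArg Subtype.val (hs r)
  have hc : ∀ u, bd u = 1 → ∀ t, t * u = u * t := by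
    intro u hu t
    have h1 := h.peiffer t u
    rw [hu, h.act_one] at h1
    nth_rewrite 2 [h1]
    group
  let φ : bd.ker × bd.range →* C :=
    { toFun := fun p => p.1.1 * s p.2
      map_one' := by simp
      map_mul' := by
        rintro ⟨⟨k, hk⟩, r⟩ ⟨⟨k', hk'⟩, r'⟩
        simp only [Prod.mk_mul_mk, Subgroup.coe_mul, map_mul, MulMemClass.mk_mul_mk]
        rw [mul_assoc k k', mul_assoc k (s r), ← mul_assoc k', ← mul_assoc (s r), hc k' hk' (s r)] }
  refine ⟨(MulEquiv.ofBijective φ ⟨?_, ?_⟩).symm⟩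
  · rw [injective_iff_map_eq_one]
    rintro ⟨⟨k, hk⟩, r⟩ hx
    have hx' : k * s r = 1 := hx
    have h2 := congrArg bd hx'
    rw [map_mul, MonoidHom.mem_ker.1 hk, hs', one_mul, map_one] at h2
    have hr : r = 1 := Subtype.ext h2
    subst hr
    rw [map_one, mul_one] at hx'
    subst hx'
    rfl
  · intro c
    refine ⟨(⟨c * (s (bd.rangeRestrict c))⁻¹, ?_⟩, bd.rangeRestrict c), ?_⟩
    · rw [MonoidHom.mem_ker, map_mul, map_inv, hs']
      simp
    · simp [φ]
end

section
/- Let ∂ : C → Γ be a crossed module over a group Γ, and suppose Γ is a free group. Then the composite of the inclusion ker ∂ → C with the canonical projection C → C^ab to the abelianization is injective. -/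
/-- If `∂ : C → Γ` is a crossed module over a free group `Γ`, then the composite of the
inclusion `ker ∂ → C` with the canonical projection `C → C^ab` is injective. -/
theorem stmt_9 {C Γ : Type*} [Group C] [Group Γ] [IsFreeGroup Γ]
    (bd : C →* Γ) (act : C → Γ → C) (h : IsCrossedModule bd act) :
    Function.Injective (fun t : bd.ker => Abelianization.of (t : C)) := by
  classical
  have hc : ∀ t ∈ bd.ker, ∀ u : C, u * t = t * u := by
    intro t ht u
    have h1 := h.peiffer u t
    rw [MonoidHom.mem_ker.1 ht, h.act_one] at h1
    calc u * t = t * (t⁻¹ * u * t) := by group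
      _ = t * u := by rw [← h1]
  have hsurj := bd.rangeRestrict_surjective
  choose f hf using hsurj
  let s : bd.range →* C := IsFreeGroup.lift (fun x => f (IsFreeGroup.of x))
  have hs : bd.rangeRestrict.comp s = MonoidHom.id _ := by
    apply IsFreeGroup.ext_hom
    intro a
    simp [s, hf]
  have hs' : ∀ x, bd (s x) = x := fun x => by
    have := DFunLike.congr_fun hs x
    exact congrArg Subtype.val this
  have hk : ∀ c, c * (s (bd.rangeRestrict c))⁻¹ ∈ bd.ker := by
    intro c
    rw [MonoidHom.mem_ker, map_mul, map_inv, hs']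
    simp
  let r : C →* bd.ker :=
    { toFun := fun c => ⟨c * (s (bd.rangeRestrict c))⁻¹, hk c⟩
      map_one' := by ext; simp
      map_mul' := by
        intro a b
        apply Subtype.ext
        simp only [map_mul, mul_inv_rev, Subgroup.coe_mul]
        have := hc _ (hk b) ((s (bd.rangeRestrict a))⁻¹)
        calc a * b * ((s (bd.rangeRestrict b))⁻¹ * (s (bd.rangeRestrict a))⁻¹)
            = a * ((b * (s (bd.rangeRestrict b))⁻¹) * (s (bd.rangeRestrict a))⁻¹) := by group
          _ = _ := by rw [← this]; group }
  letI : CommGroup bd.ker := { (inferInstance : Group bd.ker) with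
    mul_comm := fun a b => Subtype.ext (hc b b.2 a) }
  have hr : ∀ t : bd.ker, r t = t := by
    intro t
    apply Subtype.ext
    have : bd.rangeRestrict (t : C) = 1 := Subtype.ext t.2
    simp [r, this]
  intro t u htu
  have := congrArg (Abelianization.lift r) htu
  simp only [Abelianization.lift_apply_of] at this
  rwa [hr, hr] at this
end

section
/- Let ∂ : C → Γ be a crossed module over a free group Γ, let π = ker ∂ and N = range ∂. Then the sequence 0 → π → C^ab → N^ab → 0 is exact, where the first map is induced by the inclusion π → C followed by the projection to the abelianization C^ab, and the second map is induced on abelianizations by the corestriction of ∂ to N: i.e., the first map is injective, the second is surjective, and the kernel of the second equals the image of the first. -/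
/-- For a crossed module `∂ : C → Γ` over a free group `Γ`, with `π = ker ∂` and
`N = range ∂`, the sequence `0 → π → C^ab → N^ab → 0` is exact: the map `π → C^ab`
(inclusion followed by projection to the abelianization) is injective, the map
`C^ab → N^ab` induced on abelianizations by the corestriction of `∂` is surjective,
and the kernel of the latter is the image of the former. -/
theorem stmt_10 {C Γ : Type*} [Group C] [Group Γ] [IsFreeGroup Γ]
    (bd : C →* Γ) (act : C → Γ → C) (h : IsCrossedModule bd act) :
    Function.Injective (fun t : bd.ker => Abelianization.of (t : C)) ∧
    Function.Surjective (Abelianization.map bd.rangeRestrict) ∧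
    (∀ x : Abelianization C,
      Abelianization.map bd.rangeRestrict x = 1 ↔
        ∃ t : bd.ker, Abelianization.of (t : C) = x) := by
  have hcen : ∀ u : C, bd u = 1 → u ∈ Subgroup.center C := by
    intro u hu
    rw [Subgroup.mem_center_iff]
    intro t
    have h1 := h.peiffer t u
    rw [hu, h.act_one] at h1
    have h2 : u * t = u * (u⁻¹ * t * u) := congrArg (u * ·) h1
    rw [h2]; group
  have hsurj : Function.Surjective bd.rangeRestrict := bd.rangeRestrict_surjective
  obtain ⟨s, hs⟩ : ∃ s : bd.range →* C, ∀ n, bd (s n) = (n : Γ) := by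
    refine ⟨IsFreeGroup.lift (fun i => Function.surjInv hsurj (IsFreeGroup.of i)), ?_⟩
    intro n
    have : (bd.rangeRestrict.comp (IsFreeGroup.lift
        (fun i => Function.surjInv hsurj (IsFreeGroup.of i)))) = MonoidHom.id bd.range := by
      apply IsFreeGroup.ext_hom
      intro i
      simp [Function.surjInv_eq hsurj]
    have h2 := congrArg Subtype.val (DFunLike.congr_fun this n)
    simpa using h2
  have hk : ∀ c, c * (s (bd.rangeRestrict c))⁻¹ ∈ Subgroup.center C := by
    intro c
    apply hcen
    rw [map_mul, map_inv, hs]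
    simp
  let r : C →* Subgroup.center C := MonoidHom.mk' (fun c => ⟨_, hk c⟩) (by
    intro a b
    apply Subtype.ext
    have hb := Subgroup.mem_center_iff.1 (hk b) (s (bd.rangeRestrict a))⁻¹
    simp only [map_mul, mul_inv_rev, Subgroup.coe_mul]
    rw [mul_assoc a (s (bd.rangeRestrict a))⁻¹, hb]
    group)
  have hr : ∀ t : C, bd t = 1 → ((r t : Subgroup.center C) : C) = t := by
    intro t ht
    have h1 : bd.rangeRestrict t = 1 := Subtype.ext ht
    change t * (s (bd.rangeRestrict t))⁻¹ = t
    rw [h1]; simp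
  refine ⟨?_, ?_, ?_⟩
  · intro t t' htt
    letI : CommGroup (Subgroup.center C) :=
      { (inferInstance : Group (Subgroup.center C)) with
        mul_comm := fun a b => Subtype.ext (Subgroup.mem_center_iff.1 b.2 a) }
    have h1 := congrArg (Abelianization.lift (A := Subgroup.center C) r) htt
    simp only [Abelianization.lift_apply_of] at h1
    apply Subtype.ext
    rw [← hr t t.2, ← hr t' t'.2, h1]
  · intro y
    obtain ⟨n, rfl⟩ := QuotientGroup.mk_surjective y
    obtain ⟨c, rfl⟩ := hsurj n
    exact ⟨Abelianization.of c, Abelianization.map_of _ _⟩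
  · intro x
    constructor
    · intro hx
      obtain ⟨c, rfl⟩ := QuotientGroup.mk_surjective x
      have h1 : Abelianization.of (bd.rangeRestrict c) = 1 := hx
      have h2 : bd.rangeRestrict c ∈ commutator bd.range := by
        rw [← Abelianization.ker_of]; exact h1
      have h3 : commutator bd.range = (commutator C).map bd.rangeRestrict := by
        rw [commutator_def, commutator_def, Subgroup.map_commutator,
          Subgroup.map_top_of_surjective _ hsurj]
      rw [h3] at h2
      obtain ⟨d, hd, hdc⟩ := h2
      have hd1 : Abelianization.of d = 1 := by
        have : d ∈ (Abelianization.of (G := C)).ker := by rw [Abelianization.ker_of]; exact hd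
        exact this
      have hdc' : bd d = bd c := congrArg Subtype.val hdc
      refine ⟨⟨c * d⁻¹, ?_⟩, ?_⟩
      · rw [MonoidHom.mem_ker, map_mul, map_inv, hdc']; simp
      · change Abelianization.of (c * d⁻¹) = Abelianization.of c
        rw [map_mul, map_inv, hd1]; simp
    · rintro ⟨t, rfl⟩
      rw [Abelianization.map_of]
      have h1 : bd.rangeRestrict (t : C) = 1 := Subtype.ext t.2
      rw [h1, map_one]
end
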